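/- arXiv:math-ph/0002010 — 4 statements merged into one kernel-verified Lean document; each statement's English description precedes it below -/
import Mathlib

section
/- Let φ : [0,1] → ℝ be C² with φ'(x) ≥ C₁ > 0 for all x ∈ [0,1]. Then for every Schwartz function f : ℝ → ℝ, lim_{N→∞} (1/N) Σ_{j=1}^{N} Σ_{k=1}^{N} f( N (φ(j/N) − φ(k/N)) ) = Σ_{m∈ℤ} ∫_0^1 f( m φ'(x) ) dx, where the series on the right converges absolutely. -/
open MeasureTheory Filter Topology

/-- A right-endpoint Riemann sum is the integral of the corresponding step function. -/
lemma integral_natCeil_mul (h : ℕ → ℝ) {N : ℕ} (hN : 0 < N) :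
    ∫ x in (0:ℝ)..1, h ⌈(N : ℝ) * x⌉₊ = (1 / (N : ℝ)) * ∑ k ∈ Finset.Icc 1 N, h k := by
  have hN' : (0:ℝ) < N := by exact_mod_cast hN
  have hle (i : ℕ) : (i : ℝ) / N ≤ ((i + 1 : ℕ) : ℝ) / N := by
    gcongr; simp
  have hstep (i : ℕ) : Set.EqOn (fun x : ℝ => h ⌈(N : ℝ) * x⌉₊) (fun _ => h (i + 1))
      (Set.uIoc ((i : ℝ) / N) (((i + 1 : ℕ) : ℝ) / N)) := by
    intro x hx
    rw [Set.uIoc_of_le (hle i)] at hx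
    have h1 : (i : ℝ) < N * x := by
      have := hx.1
      rw [div_lt_iff₀ hN'] at this
      linarith
    have h2 : (N : ℝ) * x ≤ ((i + 1 : ℕ) : ℝ) := by
      have := hx.2
      rw [le_div_iff₀ hN'] at this
      linarith
    have : ⌈(N : ℝ) * x⌉₊ = i + 1 := by
      rw [Nat.ceil_eq_iff (by omega)]
      exact ⟨by simpa using h1, h2⟩
    simp only [this]
  have hint (i : ℕ) : IntervalIntegrable (fun x : ℝ => h ⌈(N : ℝ) * x⌉₊) volume
      ((i : ℝ) / N) (((i + 1 : ℕ) : ℝ) / N) :=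
    (intervalIntegrable_const (c := h (i + 1))).congr (hstep i).symm
  have key := intervalIntegral.sum_integral_adjacent_intervals
    (f := fun x : ℝ => h ⌈(N : ℝ) * x⌉₊) (μ := volume)
    (a := fun i : ℕ => (i : ℝ) / N) (n := N) (fun i _ => hint i)
  simp only [Nat.cast_zero, zero_div, div_self hN'.ne'] at key
  rw [← key, Finset.mul_sum, Finset.range_eq_Ico]
  have hshift := Finset.sum_Ico_add' (fun k => 1 / (N : ℝ) * h k) 0 N 1
  rw [zero_add, Finset.Ico_add_one_right_eq_Icc] at hshift
  rw [← hshift]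
  refine Finset.sum_congr rfl fun i _ => ?_
  rw [intervalIntegral.integral_congr_ae (ae_of_all _ (hstep i)), intervalIntegral.integral_const,
    smul_eq_mul]
  push_cast
  ring

/-- If two sequences converge to a point of strict differentiability and differ by `c / N`, then
the difference of the values of the function, scaled by `N`, tends to `c` times the derivative. -/
lemma HasStrictDerivAt.tendsto_natCast_mul_sub {φ : ℝ → ℝ} {d x c : ℝ}
    (hd : HasStrictDerivAt φ d x) {a b : ℕ → ℝ} (ha : Tendsto a atTop (𝓝 x))
    (hb : Tendsto b atTop (𝓝 x)) (hab : ∀ᶠ N : ℕ in atTop, b N - a N = c / N) :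
    Tendsto (fun N : ℕ => (N : ℝ) * (φ (b N) - φ (a N))) atTop (𝓝 (c * d)) := by
  have hlo := hd.isLittleO.comp_tendsto (hb.prodMk_nhds ha)
  have h1 := (Asymptotics.isBigO_refl (fun N : ℕ => (N : ℝ)) atTop).mul_isLittleO hlo
  have hEq : (fun N : ℕ => (N : ℝ) * (b N - a N)) =ᶠ[atTop] fun _ => c := by
    filter_upwards [hab, eventually_gt_atTop 0] with N h hN
    have : (N : ℝ) ≠ 0 := by positivity
    rw [h]
    field_simp
  have h2 := (h1.trans_eventuallyEq hEq).trans_isBigO (Asymptotics.isBigO_const_const c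
    (one_ne_zero (α := ℝ)) atTop)
  have h3 := ((Asymptotics.isLittleO_one_iff ℝ).1 h2).add_const (c * d)
  rw [zero_add] at h3
  refine h3.congr' ?_
  filter_upwards [hEq] with N h
  simp only [Function.comp_apply, ContinuousLinearMap.toSpanSingleton_apply, smul_eq_mul]
  linear_combination (-d) * h

/-- Summation over a block of integers, indexed by the offset from a fixed integer. -/
lemma hasSum_int_ite_add (u : ℤ → ℝ) (N : ℕ) (k : ℤ) :
    HasSum (fun m : ℤ => if 1 ≤ k + m ∧ k + m ≤ N then u (k + m) else 0)
      (∑ j ∈ Finset.Icc 1 N, u (j : ℤ)) := by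
  have h1 : HasSum (fun i : ℤ => if 1 ≤ i ∧ i ≤ N then u i else 0)
      (∑ i ∈ Finset.Icc (1:ℤ) N, if 1 ≤ i ∧ i ≤ (N : ℤ) then u i else 0) :=
    hasSum_sum_of_ne_finset_zero fun i hi => if_neg (by simpa using hi)
  have h2 : (∑ i ∈ Finset.Icc (1:ℤ) N, if 1 ≤ i ∧ i ≤ (N : ℤ) then u i else 0)
      = ∑ j ∈ Finset.Icc 1 N, u (j : ℤ) := by
    symm
    refine Finset.sum_bij (fun j _ => (j : ℤ)) ?_ ?_ ?_ ?_
    · intro j hj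
      simp only [Finset.mem_Icc] at hj ⊢
      omega
    · intro i _ j _ h
      exact_mod_cast h
    · intro i hi
      simp only [Finset.mem_Icc] at hi
      exact ⟨i.toNat, by simp only [Finset.mem_Icc]; omega, by omega⟩
    · intro j hj
      simp only [Finset.mem_Icc] at hj
      rw [if_pos (by omega)]
  rw [h2] at h1
  simpa only [Function.comp_def, Equiv.coe_addLeft] using (Equiv.addLeft k).hasSum_iff.2 h1

/-- A Schwartz function evaluated outside the intervals `(-c|m|, c|m|)`, `m ∈ ℤ`, is bounded by a
summable sequence. -/
lemma SchwartzMap.exists_summable_bound (f : SchwartzMap ℝ ℝ) {c : ℝ} (hc : 0 < c) :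
    ∃ B : ℤ → ℝ, Summable B ∧ ∀ (m : ℤ) (y : ℝ), c * |(m : ℝ)| ≤ |y| → |f y| ≤ B m := by
  obtain ⟨C, hC⟩ := f.decay 2 0
  obtain ⟨D, hD⟩ := f.decay 0 0
  simp only [norm_iteratedFDeriv_zero, Real.norm_eq_abs, pow_zero, one_mul, sq_abs] at hC hD
  have hC0 : 0 ≤ C := le_trans (by positivity) (hC.2 0)
  have hD0 : 0 ≤ D := le_trans (by positivity) (hD.2 0)
  refine ⟨fun m => C / c ^ 2 * (1 / (m : ℝ) ^ 2) + if m = 0 then D else 0, ?_, ?_⟩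
  · refine ((Real.summable_one_div_int_pow.2 one_lt_two).mul_left _).add ?_
    exact (hasSum_ite_eq (0:ℤ) D).summable
  · intro m y hy
    rcases eq_or_ne m 0 with rfl | hm
    · simpa using hD.2 y
    · have hm' : (m : ℝ) ≠ 0 := by exact_mod_cast hm
      have hsq : c ^ 2 * (m : ℝ) ^ 2 ≤ y ^ 2 := by
        rw [← sq_abs y, ← sq_abs (m : ℝ), ← mul_pow]
        gcongr
      have hpos : 0 < c ^ 2 * (m : ℝ) ^ 2 := by positivity
      simp only [hm, if_false, add_zero]
      rw [div_mul_div_comm, mul_one, le_div_iff₀ hpos, mul_comm]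
      exact (mul_le_mul_of_nonneg_right hsq (abs_nonneg _)).trans (hC.2 y)

/-- A function with derivative at least `C` on `[0, 1]` expands distances by at least `C`. -/
lemma mul_abs_sub_le_abs_image_sub {φ : ℝ → ℝ} {C : ℝ} (hφ : DifferentiableOn ℝ φ (Set.Icc 0 1))
    (hφ' : ∀ x ∈ Set.Icc (0:ℝ) 1, C ≤ derivWithin φ (Set.Icc 0 1) x)
    {a b : ℝ} (ha : a ∈ Set.Icc (0:ℝ) 1) (hb : b ∈ Set.Icc (0:ℝ) 1) :
    C * |b - a| ≤ |φ b - φ a| := by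
  have key {a b : ℝ} (ha : a ∈ Set.Icc (0:ℝ) 1) (hb : b ∈ Set.Icc (0:ℝ) 1) (hab : a ≤ b) :
      C * (b - a) ≤ φ b - φ a := by
    refine (convex_Icc (0:ℝ) 1).mul_sub_le_image_sub_of_le_deriv hφ.continuousOn
      (hφ.mono interior_subset) (fun x hx => ?_) a ha b hb hab
    rw [← derivWithin_of_mem_nhds (mem_interior_iff_mem_nhds.1 hx)]
    exact hφ' x (interior_subset hx)
  rcases le_total a b with hab | hab
  · rw [abs_of_nonneg (sub_nonneg.2 hab)]
    exact (key ha hb hab).trans (le_abs_self _)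
  · rw [abs_sub_comm, abs_sub_comm (φ b), abs_of_nonneg (sub_nonneg.2 hab)]
    exact (key hb ha hab).trans (le_abs_self _)

/-- The value of `f` at the scaled spacing between the `k`-th and `(k + m)`-th points
`φ (j / N)`, `1 ≤ j ≤ N`, extended by zero. -/
noncomputable def spacingTerm (φ f : ℝ → ℝ) (N : ℕ) (m : ℤ) (k : ℕ) : ℝ :=
  if 1 ≤ (k : ℤ) + m ∧ (k : ℤ) + m ≤ N then
    f ((N : ℝ) * (φ ((((k : ℤ) + m : ℤ) : ℝ) / N) - φ ((k : ℝ) / N))) else 0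

lemma hasSum_spacingTerm (φ f : ℝ → ℝ) (N k : ℕ) :
    HasSum (fun m : ℤ => spacingTerm φ f N m k)
      (∑ j ∈ Finset.Icc 1 N, f ((N : ℝ) * (φ ((j : ℝ) / N) - φ ((k : ℝ) / N)))) := by
  simpa only [spacingTerm, Int.cast_natCast] using hasSum_int_ite_add
    (fun i : ℤ => f ((N : ℝ) * (φ ((i : ℝ) / N) - φ ((k : ℝ) / N)))) N k

lemma tendsto_spacingTerm {φ f : ℝ → ℝ} (hf : Continuous f) {d x : ℝ} (hx : x ∈ Set.Ioo (0:ℝ) 1)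
    (hd : HasStrictDerivAt φ d x) (m : ℤ) :
    Tendsto (fun N : ℕ => spacingTerm φ f N m ⌈(N : ℝ) * x⌉₊) atTop (𝓝 (f ((m : ℝ) * d))) := by
  have ha : Tendsto (fun N : ℕ => (⌈(N : ℝ) * x⌉₊ : ℝ) / N) atTop (𝓝 x) := by
    simpa only [mul_comm x, Function.comp_def] using
      (tendsto_nat_ceil_mul_div_atTop hx.1.le).comp (tendsto_natCast_atTop_atTop (R := ℝ))
  have hb : Tendsto (fun N : ℕ => (((⌈(N : ℝ) * x⌉₊ : ℤ) + m : ℤ) : ℝ) / N) atTop (𝓝 x) := by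
    have := ha.add (tendsto_const_div_atTop_nhds_zero_nat (m : ℝ))
    rw [add_zero] at this
    refine this.congr fun N => ?_
    push_cast
    ring
  refine ((hf.tendsto _).comp (hd.tendsto_natCast_mul_sub (c := m) ha hb ?_)).congr' ?_
  · filter_upwards with N
    push_cast
    ring
  · filter_upwards [hb.eventually (Ioo_mem_nhds hx.1 hx.2), eventually_gt_atTop 0] with N h hN
    have hN' : (0:ℝ) < N := by exact_mod_cast hN
    have h1 : (0:ℤ) < (⌈(N : ℝ) * x⌉₊ : ℤ) + m := by
      have := h.1
      rw [lt_div_iff₀ hN', zero_mul] at this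
      exact_mod_cast this
    have h2 : (⌈(N : ℝ) * x⌉₊ : ℤ) + m < N := by
      have := h.2
      rw [div_lt_iff₀ hN', one_mul] at this
      exact_mod_cast this
    rw [spacingTerm, if_pos ⟨by omega, h2.le⟩]
    rfl

lemma abs_spacingTerm_le {φ f : ℝ → ℝ} {C : ℝ} (hφ : DifferentiableOn ℝ φ (Set.Icc 0 1))
    (hφ' : ∀ x ∈ Set.Icc (0:ℝ) 1, C ≤ derivWithin φ (Set.Icc 0 1) x) {B : ℤ → ℝ}
    (hB : ∀ (m : ℤ) (y : ℝ), C * |(m : ℝ)| ≤ |y| → |f y| ≤ B m) (hB0 : ∀ m, 0 ≤ B m)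
    {N k : ℕ} (hN : 0 < N) (hk : k ≤ N) (m : ℤ) :
    |spacingTerm φ f N m k| ≤ B m := by
  have hN' : (0:ℝ) < N := by exact_mod_cast hN
  rw [spacingTerm]
  split_ifs with h
  · refine hB m _ ?_
    have hk' : (k : ℝ) / N ∈ Set.Icc (0:ℝ) 1 :=
      ⟨by positivity, by rw [div_le_one hN']; exact_mod_cast hk⟩
    have hj : (((k : ℤ) + m : ℤ) : ℝ) / N ∈ Set.Icc (0:ℝ) 1 := by
      refine ⟨div_nonneg ?_ hN'.le, ?_⟩
      · exact_mod_cast (by omega : (0:ℤ) ≤ (k : ℤ) + m)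
      · rw [div_le_one hN']
        exact_mod_cast h.2
    have key := mul_abs_sub_le_abs_image_sub hφ hφ' hk' hj
    have hdiff : (((k : ℤ) + m : ℤ) : ℝ) / N - (k : ℝ) / N = m / N := by
      push_cast
      ring
    rw [hdiff, abs_div, abs_of_pos hN', ← mul_div_assoc, div_le_iff₀ hN'] at key
    rw [abs_mul, abs_of_pos hN', mul_comm (N : ℝ)]
    exact key
  · simpa using hB0 m

/-- Level spacings for integrable quantum maps in genus zero (Zelditch), Theorem A
(concrete genus-zero instance): the pair correlation measure of the eigenvalues
`φ(j/N)`, rescaled to unit mean spacing, converges weakly to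
`∑_{m ∈ ℤ} ∫_0^1 f(m φ'(x)) dx`, and this series converges absolutely. -/
theorem pair_correlation_of_quantized_hamiltonian
    (φ : ℝ → ℝ) (C₁ : ℝ) (hC₁ : 0 < C₁)
    (hφ : ContDiffOn ℝ 2 φ (Set.Icc 0 1))
    (hφ' : ∀ x ∈ Set.Icc (0:ℝ) 1, C₁ ≤ derivWithin φ (Set.Icc 0 1) x)
    (f : SchwartzMap ℝ ℝ) :
    (Summable fun m : ℤ =>
      ∫ x in (0:ℝ)..1, |f ((m : ℝ) * derivWithin φ (Set.Icc 0 1) x)|) ∧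
    Tendsto
      (fun N : ℕ => (1 / (N : ℝ)) * ∑ j ∈ Finset.Icc 1 N, ∑ k ∈ Finset.Icc 1 N,
        f ((N : ℝ) * (φ ((j : ℝ) / N) - φ ((k : ℝ) / N))))
      atTop
      (𝓝 (∑' m : ℤ, ∫ x in (0:ℝ)..1, f ((m : ℝ) * derivWithin φ (Set.Icc 0 1) x))) := by
  obtain ⟨B, hBs, hB⟩ := f.exists_summable_bound hC₁
  have hB0 (m : ℤ) : 0 ≤ B m := (abs_nonneg _).trans (hB m (C₁ * |(m : ℝ)|) (le_abs_self _))
  have hdiff : DifferentiableOn ℝ φ (Set.Icc 0 1) := hφ.differentiableOn (by norm_num)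
  refine ⟨?_, ?_⟩
  · refine Summable.of_norm_bounded hBs fun m => ?_
    have := intervalIntegral.norm_integral_le_of_norm_le_const (a := (0:ℝ)) (b := 1) (C := B m)
      (f := fun x => |f ((m : ℝ) * derivWithin φ (Set.Icc 0 1) x)|) fun x hx => ?_
    · simpa using this
    rw [Set.uIoc_of_le zero_le_one] at hx
    have hx' := hφ' x (Set.Ioc_subset_Icc_self hx)
    rw [Real.norm_eq_abs, abs_abs]
    refine hB m _ ?_
    rw [abs_mul, mul_comm]
    gcongr
    exact hx'.trans (le_abs_self _)
  have hceil {N : ℕ} {x : ℝ} (hx : x ∈ Set.uIoc (0:ℝ) 1) : ⌈(N : ℝ) * x⌉₊ ≤ N := by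
    rw [Set.uIoc_of_le zero_le_one] at hx
    exact Nat.ceil_le.2 (mul_le_of_le_one_right (Nat.cast_nonneg N) hx.2)
  have hlim := tendsto_tsum_of_dominated_convergence (𝓕 := atTop) (bound := B)
    (f := fun (N : ℕ) (m : ℤ) => ∫ x in (0:ℝ)..1, spacingTerm φ f N m ⌈(N : ℝ) * x⌉₊)
    (g := fun m : ℤ => ∫ x in (0:ℝ)..1, f ((m : ℝ) * derivWithin φ (Set.Icc 0 1) x))
    hBs (fun m => ?_) ?_
  · refine hlim.congr' ?_
    filter_upwards [eventually_gt_atTop 0] with N hN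
    simp only [integral_natCeil_mul (spacingTerm φ f N _) hN]
    rw [Finset.sum_comm]
    exact ((hasSum_sum fun k _ => hasSum_spacingTerm φ f N k).mul_left (1 / (N : ℝ))).tsum_eq
  · refine intervalIntegral.tendsto_integral_filter_of_dominated_convergence (fun _ => B m)
      ?_ ?_ intervalIntegrable_const ?_
    · filter_upwards with N
      have hceil_meas : Measurable fun x : ℝ => ⌈(N : ℝ) * x⌉₊ :=
        Nat.measurable_ceil.comp (measurable_const_mul _)
      exact ((measurable_of_countable (spacingTerm φ f N m)).comp
        hceil_meas).aestronglyMeasurable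
    · filter_upwards [eventually_gt_atTop 0] with N hN
      filter_upwards with x hx
      exact abs_spacingTerm_le hdiff hφ' hB hB0 hN (hceil hx) m
    · filter_upwards [Measure.ae_ne volume (1:ℝ)] with x hx1 hx
      rw [Set.uIoc_of_le zero_le_one] at hx
      have hx' : x ∈ Set.Ioo (0:ℝ) 1 := ⟨hx.1, lt_of_le_of_ne hx.2 hx1⟩
      have hnhds : Set.Icc (0:ℝ) 1 ∈ 𝓝 x := Icc_mem_nhds hx'.1 hx'.2
      rw [derivWithin_of_mem_nhds hnhds]
      exact tendsto_spacingTerm f.continuous hx'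
        ((hφ.contDiffAt hnhds).hasStrictDerivAt (by norm_num)) m
  · filter_upwards [eventually_gt_atTop 0] with N hN m
    have := intervalIntegral.norm_integral_le_of_norm_le_const (a := (0:ℝ)) (b := 1) (C := B m)
      (f := fun x => spacingTerm φ f N m ⌈(N : ℝ) * x⌉₊)
      fun x hx => abs_spacingTerm_le hdiff hφ' hB hB0 hN (hceil hx) m
    simpa using this
end

section
/- Let φ : [0,1] → ℝ be C¹ with |φ'(x)| ≥ C₁ > 0 for all x, let A ≥ 0, and for each N ∈ ℕ let ε_N : [0,1] → ℝ be C¹ with sup_{x∈[0,1]} (|ε_N(x)| + |ε_N'(x)|) ≤ A/N; set Φ_N = φ + ε_N. Let f be a Schwartz function whose Fourier transform f̂ is compactly supported, and let a < b be real numbers. Then lim_{N→∞} (1/(b−a)) ∫_a^b ρ_{2,t}^{(N)}(f) dt = f(0) + f̂(0), where ρ_{2,t}^{(N)}(f) = (1/N²) Σ_{ℓ∈ℤ} f̂(2πℓ/N) |S_t(N,ℓ)|² and S_t(N,ℓ) = Σ_{j=1}^N exp(i t ℓ N Φ_N(j/N)). -/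
open MeasureTheory Filter Topology Real

/-- Fourier transform with the convention `f̂(ξ) = ∫ f(x) e^{-i x ξ} dx`. -/
noncomputable def FT (f : ℝ → ℝ) (ξ : ℝ) : ℂ :=
  ∫ x : ℝ, (f x : ℂ) * Complex.exp (-(Complex.I * x * ξ))

theorem norm_FT_le (f : ℝ → ℝ) (ξ : ℝ) : ‖FT f ξ‖ ≤ ∫ x, |f x| := by
  refine (norm_integral_le_integral_norm _).trans (le_of_eq ?_)
  congr 1 with x
  have : -(Complex.I * x * ξ) = ((-(x * ξ) : ℝ) : ℂ) * Complex.I := by push_cast; ring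
  rw [norm_mul, this, Complex.norm_exp_ofReal_mul_I, mul_one, Complex.norm_real, Real.norm_eq_abs]

theorem exists_nat_forall_FT_eq_zero {f : ℝ → ℝ} (hf : HasCompactSupport (FT f)) :
    ∃ M : ℕ, 1 ≤ M ∧ ∀ ξ : ℝ, (M : ℝ) < |ξ| → FT f ξ = 0 := by
  obtain ⟨R, hR⟩ := hf.isCompact.isBounded.exists_norm_le
  obtain ⟨M, hM⟩ := exists_nat_ge (max R 1)
  refine ⟨M, by exact_mod_cast (le_max_right _ _).trans hM, fun ξ hξ => ?_⟩
  by_contra h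
  have h1 := hR ξ (subset_closure h)
  rw [Real.norm_eq_abs] at h1
  linarith [le_max_left R 1]

theorem FT_lattice_eq_zero {f : ℝ → ℝ} {M : ℕ} (hM : ∀ ξ : ℝ, (M : ℝ) < |ξ| → FT f ξ = 0)
    {N : ℕ} (hN : 1 ≤ N) {ℓ : ℤ} (hℓ : ℓ ∉ Finset.Icc (-((M * N : ℕ) : ℤ)) ((M * N : ℕ) : ℤ)) :
    FT f (2 * π * ℓ / N) = 0 := by
  apply hM
  have hN' : (0 : ℝ) < N := by exact_mod_cast hN
  rw [Finset.mem_Icc, ← abs_le, not_le] at hℓ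
  have h1 : (M : ℝ) * N < |(ℓ : ℝ)| := by exact_mod_cast hℓ
  rw [abs_div, abs_of_pos hN', lt_div_iff₀ hN', abs_mul, abs_of_pos (by positivity : 0 < 2 * π)]
  nlinarith [Real.pi_gt_three, abs_nonneg (ℓ : ℝ)]

open scoped SchwartzMap FourierTransform in
/-- Poisson summation for the lattice `N ℤ` in the normalisation of `FT`. -/
theorem tsum_FT_lattice (f : 𝓢(ℝ, ℝ)) {N : ℕ} (hN : 1 ≤ N) :
    ∑' ℓ : ℤ, ((1 / N : ℝ) : ℂ) * FT f (2 * π * ℓ / N) = ∑' k : ℤ, ((f (N * k) : ℝ) : ℂ) := by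
  have hN' : (N : ℝ) ≠ 0 := by positivity
  let G : 𝓢(ℝ, ℂ) := SchwartzMap.compCLMOfContinuousLinearEquiv ℝ
    (ContinuousLinearEquiv.unitsEquivAut ℝ (Units.mk0 (N : ℝ) hN'))
    (f.postcompCLM Complex.ofRealCLM)
  have hG : ∀ x, G x = ((f (N * x) : ℝ) : ℂ) := fun x => by
    simp [G, mul_comm]
  have key : ∀ w : ℝ, 𝓕 (G : ℝ → ℂ) w = ((1 / N : ℝ) : ℂ) * FT f (2 * π * w / N) := fun w => by
    rw [Real.fourier_real_eq_integral_exp_smul]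
    have := Measure.integral_comp_mul_left
      (fun u : ℝ => (f u : ℂ) * Complex.exp (-(Complex.I * u * (2 * π * w / N : ℝ)))) (N : ℝ)
    rw [abs_of_nonneg (by positivity), Complex.real_smul] at this
    rw [one_div, FT, ← this]
    congr 1 with v
    rw [hG, smul_eq_mul, mul_comm]
    congr 2
    have hNc : (N : ℂ) ≠ 0 := by exact_mod_cast hN'
    push_cast
    field_simp
  have h := G.tsum_eq_tsum_fourier 0
  simp only [zero_add, hG] at h
  rw [h]
  congr 1 with ℓ
  rw [SchwartzMap.fourier_coe, key]
  simp

open scoped SchwartzMap in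
theorem tendsto_tsum_dilate (f : 𝓢(ℝ, ℝ)) :
    Tendsto (fun N : ℕ => ∑' k : ℤ, ((f (N * k) : ℝ) : ℂ)) atTop (𝓝 (f 0 : ℂ)) := by
  obtain ⟨C, -, hC⟩ := f.decay 2 0
  simp only [norm_iteratedFDeriv_zero] at hC
  have h0 : (f 0 : ℂ) = ∑' k : ℤ, if k = 0 then (f 0 : ℂ) else 0 := by
    rw [tsum_ite_eq]
  rw [h0]
  have hsum : Summable fun k : ℤ => C * (1 / (k : ℝ) ^ 2) + if k = 0 then |f 0| else 0 :=
    ((Real.summable_one_div_int_pow.2 one_lt_two).mul_left C).add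
      (hasSum_ite_eq (0 : ℤ) |f 0|).summable
  have hbd : ∀ N : ℕ, 1 ≤ N → ∀ k : ℤ, k ≠ 0 → |f (N * k)| ≤ C * (1 / (k : ℝ) ^ 2) / N := by
    intro N hN k hk
    have hN' : (1 : ℝ) ≤ N := by exact_mod_cast hN
    have hk' : 0 < (k : ℝ) ^ 2 := by positivity
    have h1 := hC (N * k)
    rw [Real.norm_eq_abs, Real.norm_eq_abs, sq_abs, mul_pow] at h1
    rw [mul_one_div, div_div, le_div_iff₀ (by positivity)]
    nlinarith [mul_nonneg hk'.le (abs_nonneg (f (N * k))), mul_nonneg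
      (mul_nonneg hk'.le (abs_nonneg (f (N * k)))) (by nlinarith : (0 : ℝ) ≤ (N : ℝ) ^ 2 - N)]
  refine tendsto_tsum_of_dominated_convergence hsum (fun k => ?_) ?_
  · split_ifs with hk
    · simp [hk]
    · refine squeeze_zero_norm' ?_ (tendsto_const_div_atTop_nhds_zero_nat (C * (1 / (k : ℝ) ^ 2)))
      filter_upwards [eventually_ge_atTop 1] with N hN
      rw [Complex.norm_real, Real.norm_eq_abs]
      exact hbd N hN k hk
  · filter_upwards [eventually_ge_atTop 1] with N hN k
    rw [Complex.norm_real, Real.norm_eq_abs]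
    split_ifs with hk
    · simp [hk]
    · have hN' : (1 : ℝ) ≤ N := by exact_mod_cast hN
      rw [add_zero]
      have h1 := hbd N hN k hk
      exact h1.trans (div_le_self ((div_nonneg_iff.1 ((abs_nonneg _).trans h1)).elim
        (fun h => h.1) (fun h => absurd h.2 (by linarith))) hN')

theorem sum_Icc_one_div_abs_le (n : ℕ) :
    ∑ m ∈ Finset.Icc (-(n : ℤ)) n, 1 / |(m : ℝ)| ≤ 2 * (1 + Real.log n) := by
  have h : ∑ m ∈ Finset.Icc (-(n : ℤ)) n, 1 / |(m : ℝ)| = 2 * ((harmonic n : ℚ) : ℝ) := by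
    induction n with
    | zero => simp
    | succ n ih =>
      have hs : Finset.Icc (-((n + 1 : ℕ) : ℤ)) ((n + 1 : ℕ) : ℤ) =
          insert (-((n : ℤ) + 1)) (insert ((n : ℤ) + 1) (Finset.Icc (-(n : ℤ)) n)) := by
        ext m; simp only [Finset.mem_Icc, Finset.mem_insert]; omega
      have hn : (0 : ℝ) ≤ (n : ℝ) + 1 := by positivity
      rw [hs, Finset.sum_insert (by simp only [Finset.mem_insert, Finset.mem_Icc]; omega),
        Finset.sum_insert (by simp), ih, harmonic_succ]
      push_cast
      rw [abs_neg, abs_of_nonneg hn]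
      ring
  rw [h]
  linarith [harmonic_le_one_add_log n]

theorem sum_one_div_abs_sub_le {N j : ℕ} (hj : j ∈ Finset.Icc 1 N) :
    ∑ k ∈ Finset.Icc 1 N, 1 / |(j : ℝ) - k| ≤ 2 * (1 + Real.log N) := by
  refine le_trans ?_ (sum_Icc_one_div_abs_le N)
  have : ∑ k ∈ Finset.Icc 1 N, 1 / |(j : ℝ) - k| =
      ∑ m ∈ (Finset.Icc 1 N).image (fun k : ℕ => (j : ℤ) - k), 1 / |(m : ℝ)| := by
    rw [Finset.sum_image (fun x _ y _ h => by simpa using h)]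
    simp
  rw [this]
  refine Finset.sum_le_sum_of_subset_of_nonneg (fun m hm => ?_) fun _ _ _ => by positivity
  simp only [Finset.mem_image, Finset.mem_Icc] at hm hj ⊢
  omega

theorem normSq_sum_exp {ι : Type*} (s : Finset ι) (θ : ι → ℝ) (t : ℝ) :
    ‖∑ j ∈ s, Complex.exp (Complex.I * ((t * θ j : ℝ) : ℂ))‖ ^ 2 =
      ∑ j ∈ s, ∑ k ∈ s, Real.cos ((θ j - θ k) * t) := by
  have h : ∀ j, Complex.exp (Complex.I * ((t * θ j : ℝ) : ℂ)) =
      ⟨Real.cos (t * θ j), Real.sin (t * θ j)⟩ := fun j => by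
    rw [mul_comm, Complex.exp_mul_I, ← Complex.ofReal_cos, ← Complex.ofReal_sin]
    apply Complex.ext <;> simp [-Complex.ofReal_cos, -Complex.ofReal_sin]
  rw [← Complex.normSq_eq_norm_sq, Complex.normSq_apply, Complex.re_sum, Complex.im_sum,
    Finset.sum_mul_sum, Finset.sum_mul_sum, ← Finset.sum_add_distrib]
  refine Finset.sum_congr rfl fun j _ => ?_
  rw [← Finset.sum_add_distrib]
  refine Finset.sum_congr rfl fun k _ => ?_
  rw [h, h, ← Real.cos_sub]
  congr 1
  ring

theorem abs_integral_cos_mul_le (a b : ℝ) {ω : ℝ} (hω : ω ≠ 0) :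
    |∫ t in a..b, Real.cos (ω * t)| ≤ 2 / |ω| := by
  rw [intervalIntegral.integral_comp_mul_left _ hω, integral_cos, smul_eq_mul, abs_mul, abs_inv,
    inv_mul_eq_div]
  gcongr
  refine (abs_sub _ _).trans ?_
  linarith [Real.abs_sin_le_one (ω * a), Real.abs_sin_le_one (ω * b)]

/-- Mean square of an exponential sum whose frequencies are `κ`-separated. -/
theorem abs_integral_normSq_sum_exp_sub_le {N : ℕ} {θ : ℕ → ℝ} {κ : ℝ} (hκ : 0 < κ)
    (hθ : ∀ j ∈ Finset.Icc 1 N, ∀ k ∈ Finset.Icc 1 N, κ * |(j : ℝ) - k| ≤ |θ j - θ k|)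
    (a b : ℝ) :
    |(∫ t in a..b, ‖∑ j ∈ Finset.Icc 1 N, Complex.exp (Complex.I * ((t * θ j : ℝ) : ℂ))‖ ^ 2) -
      (b - a) * N| ≤ 4 / κ * N * (1 + Real.log N) := by
  simp_rw [normSq_sum_exp]
  have hint : ∀ j k, IntervalIntegrable (fun t => Real.cos ((θ j - θ k) * t)) volume a b :=
    fun j k => (by fun_prop : Continuous _).intervalIntegrable _ _
  rw [intervalIntegral.integral_finsetSum fun j _ => by
    exact (by fun_prop : Continuous _).intervalIntegrable _ _]
  simp_rw [fun j => intervalIntegral.integral_finsetSum (s := Finset.Icc 1 N)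
    fun k (_ : k ∈ Finset.Icc 1 N) => hint j k]
  have hdiag : (b - a) * N = ∑ j ∈ Finset.Icc 1 N, ∑ k ∈ Finset.Icc 1 N,
      if j = k then b - a else 0 := by
    rw [Finset.sum_congr rfl fun j hj => by
      rw [Finset.sum_ite_eq, if_pos hj]]
    rw [Finset.sum_const, Nat.card_Icc, nsmul_eq_mul, Nat.add_sub_cancel, mul_comm]
  rw [hdiag, ← Finset.sum_sub_distrib]
  simp_rw [← Finset.sum_sub_distrib]
  calc _ ≤ ∑ j ∈ Finset.Icc 1 N, ∑ k ∈ Finset.Icc 1 N, 2 / κ * (1 / |(j : ℝ) - k|) := by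
        refine (Finset.abs_sum_le_sum_abs _ _).trans (Finset.sum_le_sum fun j hj => ?_)
        refine (Finset.abs_sum_le_sum_abs _ _).trans (Finset.sum_le_sum fun k hk => ?_)
        split_ifs with hjk
        · simp [hjk]
        · have hpos : 0 < |(j : ℝ) - k| := abs_pos.2 (sub_ne_zero.2 (by exact_mod_cast hjk))
          have h1 := hθ j hj k hk
          rw [sub_zero, div_mul_div_comm, mul_one]
          refine (abs_integral_cos_mul_le a b
            (abs_pos.1 ((mul_pos hκ hpos).trans_le h1))).trans ?_
          gcongr
    _ ≤ ∑ j ∈ Finset.Icc 1 N, 2 / κ * (2 * (1 + Real.log N)) := by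
        refine Finset.sum_le_sum fun j hj => ?_
        rw [← Finset.mul_sum]
        gcongr
        exact sum_one_div_abs_sub_le hj
    _ = _ := by
        rw [Finset.sum_const, Nat.card_Icc, nsmul_eq_mul, Nat.add_sub_cancel]
        ring

theorem mul_abs_sub_le_of_derivWithin {φ ψ : ℝ → ℝ} {c d : ℝ}
    (hφ : ContDiffOn ℝ 1 φ (Set.Icc 0 1)) (hψ : ContDiffOn ℝ 1 ψ (Set.Icc 0 1))
    (hφ' : ∀ x ∈ Set.Icc (0 : ℝ) 1, c ≤ |derivWithin φ (Set.Icc 0 1) x|)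
    (hψ' : ∀ x ∈ Set.Icc (0 : ℝ) 1, |derivWithin ψ (Set.Icc 0 1) x| ≤ d)
    {x y : ℝ} (hx : x ∈ Set.Icc (0 : ℝ) 1) (hy : y ∈ Set.Icc (0 : ℝ) 1) :
    (c - d) * |x - y| ≤ |(φ x + ψ x) - (φ y + ψ y)| := by
  wlog hxy : x < y generalizing x y
  · rcases eq_or_lt_of_le (not_lt.1 hxy) with h | h
    · simp [h]
    · rw [abs_sub_comm x, abs_sub_comm (φ x + ψ x)]
      exact this hy hx h
  have hsub : Set.Icc x y ⊆ Set.Icc 0 1 := Set.Icc_subset_Icc hx.1 hy.2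
  have hnhds : ∀ z ∈ Set.Ioo x y, Set.Icc (0 : ℝ) 1 ∈ 𝓝 z := fun z hz =>
    Icc_mem_nhds (hx.1.trans_lt hz.1) (hz.2.trans_le hy.2)
  have hd : ∀ {g : ℝ → ℝ}, ContDiffOn ℝ 1 g (Set.Icc 0 1) → ∀ z ∈ Set.Ioo x y,
      HasDerivAt g (derivWithin g (Set.Icc 0 1) z) z := fun hg z hz =>
    ((hg.differentiableOn one_ne_zero z (hsub (Set.Ioo_subset_Icc_self hz))).hasDerivWithinAt
      ).hasDerivAt (hnhds z hz)
  obtain ⟨z, hz, h⟩ := exists_hasDerivAt_eq_slope (fun u => φ u + ψ u) _ hxy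
    ((hφ.continuousOn.add hψ.continuousOn).mono hsub)
    fun z hz => (hd hφ z hz).add (hd hψ z hz)
  have hz' := hsub (Set.Ioo_subset_Icc_self hz)
  have hne : y - x ≠ 0 := by linarith
  rw [eq_div_iff hne] at h
  rw [abs_sub_comm x, abs_sub_comm (φ x + ψ x), ← h, abs_mul]
  gcongr
  have h1 := abs_sub_abs_le_abs_sub (derivWithin φ (Set.Icc 0 1) z)
    (-derivWithin ψ (Set.Icc 0 1) z)
  rw [abs_neg, sub_neg_eq_add] at h1
  linarith [hφ' z hz', hψ' z hz']

theorem abs_mean_normSq_sub_le {Φ : ℝ → ℝ} {c : ℝ} (hc : 0 < c)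
    (hΦ : ∀ x ∈ Set.Icc (0 : ℝ) 1, ∀ y ∈ Set.Icc (0 : ℝ) 1, c * |x - y| ≤ |Φ x - Φ y|)
    {a b : ℝ} (hab : a < b) {N : ℕ} (hN : 1 ≤ N) (ℓ : ℤ) :
    |(∫ t in a..b, ‖∑ j ∈ Finset.Icc 1 N, Complex.exp (Complex.I *
        ((t * ℓ * N * Φ ((j : ℝ) / N) : ℝ) : ℂ))‖ ^ 2) / ((b - a) * N ^ 2) -
        (1 / N + if ℓ = 0 then 1 else 0)| ≤
      4 / (c * (b - a)) * ((1 + Real.log N) / N) * (1 / |(ℓ : ℝ)|) +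
        if ℓ = 0 then 1 / (N : ℝ) else 0 := by
  have hba : 0 < b - a := sub_pos.2 hab
  have hN' : (0 : ℝ) < N := by exact_mod_cast hN
  split_ifs with hℓ
  · subst hℓ
    have h1 : (b - a) * (N : ℝ) ^ 2 / ((b - a) * N ^ 2) = 1 := div_self (by positivity)
    simp [h1]
  · have hℓ' : 0 < |(ℓ : ℝ)| := abs_pos.2 (by exact_mod_cast hℓ)
    have hmem : ∀ j ∈ Finset.Icc 1 N, (j : ℝ) / N ∈ Set.Icc (0 : ℝ) 1 := fun j hj =>
      ⟨by positivity, (div_le_one hN').2 (by exact_mod_cast (Finset.mem_Icc.1 hj).2)⟩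
    have h := abs_integral_normSq_sum_exp_sub_le (θ := fun j => ℓ * N * Φ ((j : ℝ) / N))
      (mul_pos hℓ' hc) (N := N) (fun j hj k hk => by
        have h1 := hΦ _ (hmem j hj) _ (hmem k hk)
        rw [← sub_div, abs_div, abs_of_pos hN', ← mul_div_assoc, div_le_iff₀ hN'] at h1
        rw [← mul_sub, abs_mul, abs_mul, abs_of_pos hN', mul_assoc, mul_assoc, mul_comm (N : ℝ)]
        gcongr) a b
    simp_rw [← mul_assoc] at h
    generalize (∫ t in a..b, ‖∑ j ∈ Finset.Icc 1 N, Complex.exp (Complex.I *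
        ((t * ℓ * N * Φ ((j : ℝ) / N) : ℝ) : ℂ))‖ ^ 2) = X at h ⊢
    have hX : X / ((b - a) * N ^ 2) - (1 / N + 0) =
        (X - (b - a) * N) / ((b - a) * N ^ 2) := by field_simp; ring
    rw [hX, abs_div, abs_of_pos (by positivity : (0 : ℝ) < (b - a) * N ^ 2),
      div_le_iff₀ (by positivity)]
    refine h.trans (le_of_eq ?_)
    field_simp
    ring

theorem tendsto_log_mul_log_div (M : ℕ) (hM : 1 ≤ M) :
    Tendsto (fun N : ℕ => (1 + Real.log N) / N * (1 + Real.log (M * N : ℕ))) atTop (𝓝 0) := by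
  have h : ∀ n : ℕ, Tendsto (fun N : ℕ => Real.log N ^ n / N) atTop (𝓝 0) := fun n =>
    (Real.isLittleO_pow_log_id_atTop.tendsto_div_nhds_zero).comp tendsto_natCast_atTop_atTop
  have key := ((h 0).const_mul (1 + Real.log M)).add
    (((h 1).const_mul (2 + Real.log M)).add (h 2))
  simp only [mul_zero, add_zero] at key
  refine key.congr' ?_
  filter_upwards [eventually_ge_atTop 1] with N hN
  have hN' : (N : ℝ) ≠ 0 := by positivity
  rw [Nat.cast_mul, Real.log_mul (by positivity) hN']
  field_simp
  ring

/-- Zelditch, Theorem B(a) (Theorem 4.6.1): the pair correlation function of the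
quantization `U_{t,N} = exp(i t N Φ_N(Î))` of a perfect Morse Hamiltonian flow on CP¹
is Poisson on average in `t`:
`(1/(b-a)) ∫_a^b ρ_{2,t}^{(N)}(f) dt → f(0) + f̂(0)`. -/
theorem pair_correlation_poisson_on_average
    (φ : ℝ → ℝ) (C₁ : ℝ) (hC₁ : 0 < C₁)
    (hφ : ContDiffOn ℝ 1 φ (Set.Icc 0 1))
    (hφ' : ∀ x ∈ Set.Icc (0:ℝ) 1, C₁ ≤ |derivWithin φ (Set.Icc 0 1) x|)
    (A : ℝ) (hA : 0 ≤ A) (ε : ℕ → ℝ → ℝ)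
    (hε : ∀ N : ℕ, 1 ≤ N → ContDiffOn ℝ 1 (ε N) (Set.Icc 0 1))
    (hεbd : ∀ N : ℕ, 1 ≤ N → ∀ x ∈ Set.Icc (0:ℝ) 1,
      |ε N x| + |derivWithin (ε N) (Set.Icc 0 1) x| ≤ A / N)
    (f : SchwartzMap ℝ ℝ) (hf : HasCompactSupport (FT f))
    (a b : ℝ) (hab : a < b) :
    Tendsto
      (fun N : ℕ => ((1 / (b - a) : ℝ) : ℂ) * ∫ t in a..b,
        ((1 / (N : ℝ) ^ 2 : ℝ) : ℂ) * ∑' ℓ : ℤ, FT f (2 * π * ℓ / N) *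
          ((‖∑ j ∈ Finset.Icc 1 N, Complex.exp (Complex.I *
              ((t * ℓ * N * (φ ((j : ℝ) / N) + ε N ((j : ℝ) / N)) : ℝ) : ℂ))‖ ^ 2 : ℝ) : ℂ))
      atTop (𝓝 ((f 0 : ℂ) + FT f 0)) := by
  obtain ⟨M, hM1, hM⟩ := exists_nat_forall_FT_eq_zero hf
  set K : ℝ := ∫ x, |f x|
  have hK : 0 ≤ K := integral_nonneg fun _ => abs_nonneg _
  have hba : 0 < b - a := sub_pos.2 hab
  have hlim := ((((tendsto_log_mul_log_div M hM1).const_mul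
    (4 / (C₁ / 2 * (b - a)) * 2)).add tendsto_one_div_atTop_nhds_zero_nat).const_mul K)
  rw [mul_zero, add_zero, mul_zero] at hlim
  have hmain := (tendsto_tsum_dilate f).add_const (FT f 0)
  rw [← add_zero ((f 0 : ℂ) + FT f 0)]
  refine ((hmain.add (squeeze_zero_norm' (f := fun N : ℕ => _ - _) ?_ hlim)).congr
    fun N => add_sub_cancel _ _)
  filter_upwards [eventually_ge_atTop 1,
    tendsto_natCast_atTop_atTop.eventually_ge_atTop (2 * A / C₁)] with N hN hNA
  have hN' : (0 : ℝ) < N := by exact_mod_cast hN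
  have hNA' : A / N ≤ C₁ / 2 := by
    rw [div_le_iff₀ hC₁] at hNA
    rw [div_le_iff₀ hN']
    linarith
  have hsep : ∀ x ∈ Set.Icc (0 : ℝ) 1, ∀ y ∈ Set.Icc (0 : ℝ) 1,
      C₁ / 2 * |x - y| ≤ |(φ x + ε N x) - (φ y + ε N y)| := fun x hx y hy => by
    have h := mul_abs_sub_le_of_derivWithin (d := C₁ / 2) hφ (hε N hN) hφ' (fun z hz => by
      linarith [hεbd N hN z hz, abs_nonneg (ε N z)]) hx hy
    rwa [sub_half] at h
  have hmean := abs_mean_normSq_sub_le (Φ := fun x => φ x + ε N x) (half_pos hC₁) hsep hab hN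
  set S : ℝ → ℤ → ℝ := fun t ℓ => ‖∑ j ∈ Finset.Icc 1 N, Complex.exp (Complex.I *
    ((t * ℓ * N * (φ ((j : ℝ) / N) + ε N ((j : ℝ) / N)) : ℝ) : ℂ))‖ ^ 2 with hS
  set L := Finset.Icc (-((M * N : ℕ) : ℤ)) ((M * N : ℕ) : ℤ)
  have h0L : (0 : ℤ) ∈ L :=
    Finset.mem_Icc.2 ⟨neg_nonpos.2 (Int.natCast_nonneg _), Int.natCast_nonneg _⟩
  have hScont : ∀ ℓ, Continuous fun t => S t ℓ := fun ℓ => by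
    simp only [hS]
    fun_prop
  have hzero : ∀ ℓ ∉ L, FT f (2 * π * ℓ / N) = 0 := fun ℓ hℓ => FT_lattice_eq_zero hM hN hℓ
  have havg : ((1 / (b - a) : ℝ) : ℂ) * ∫ t in a..b, ((1 / (N : ℝ) ^ 2 : ℝ) : ℂ) *
      ∑' ℓ : ℤ, FT f (2 * π * ℓ / N) * (S t ℓ : ℂ) =
      ∑ ℓ ∈ L, FT f (2 * π * ℓ / N) * (((∫ t in a..b, S t ℓ) / ((b - a) * N ^ 2) : ℝ) : ℂ) := by
    have h1 : ∀ t, ∑' ℓ : ℤ, FT f (2 * π * ℓ / N) * (S t ℓ : ℂ) =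
        ∑ ℓ ∈ L, FT f (2 * π * ℓ / N) * (S t ℓ : ℂ) := fun t =>
      tsum_eq_sum fun ℓ hℓ => by rw [hzero ℓ hℓ, zero_mul]
    have hint : ∀ ℓ : ℤ, IntervalIntegrable (fun t => FT f (2 * π * ℓ / N) * (S t ℓ : ℂ))
        volume a b := fun ℓ =>
      (continuous_const.mul (Complex.continuous_ofReal.comp (hScont ℓ))).intervalIntegrable _ _
    simp_rw [h1]
    rw [intervalIntegral.integral_const_mul, intervalIntegral.integral_finsetSum fun ℓ _ => hint ℓ,
      Finset.mul_sum, Finset.mul_sum]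
    refine Finset.sum_congr rfl fun ℓ _ => ?_
    rw [intervalIntegral.integral_const_mul, intervalIntegral.integral_ofReal]
    push_cast
    field_simp
  have hpoisson : ∑' k : ℤ, ((f (N * k) : ℝ) : ℂ) + FT f 0 =
      ∑ ℓ ∈ L, FT f (2 * π * ℓ / N) * ((1 / N + if ℓ = 0 then 1 else 0 : ℝ) : ℂ) := by
    rw [← tsum_FT_lattice f hN, tsum_eq_sum (s := L) fun ℓ hℓ => by rw [hzero ℓ hℓ, mul_zero]]
    have h0 : FT f 0 = ∑ ℓ ∈ L, if ℓ = 0 then FT f (2 * π * ℓ / N) else 0 := by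
      rw [Finset.sum_ite_eq', if_pos h0L]
      simp
    rw [h0, ← Finset.sum_add_distrib]
    refine Finset.sum_congr rfl fun ℓ _ => ?_
    split_ifs <;> push_cast <;> ring
  rw [havg, hpoisson, ← Finset.sum_sub_distrib]
  simp_rw [← mul_sub, ← Complex.ofReal_sub]
  calc _ ≤ ∑ ℓ ∈ L, K * (4 / (C₁ / 2 * (b - a)) * ((1 + Real.log N) / N) * (1 / |(ℓ : ℝ)|) +
        if ℓ = 0 then 1 / (N : ℝ) else 0) := by
        refine (norm_sum_le _ _).trans (Finset.sum_le_sum fun ℓ _ => ?_)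
        rw [norm_mul, Complex.norm_real, Real.norm_eq_abs]
        exact mul_le_mul (norm_FT_le _ _) (hmean ℓ) (abs_nonneg _) hK
    _ = K * (4 / (C₁ / 2 * (b - a)) * ((1 + Real.log N) / N) * ∑ ℓ ∈ L, 1 / |(ℓ : ℝ)| +
        1 / N) := by
        rw [← Finset.mul_sum, Finset.sum_add_distrib, ← Finset.mul_sum, Finset.sum_ite_eq',
          if_pos h0L]
    _ ≤ K * (4 / (C₁ / 2 * (b - a)) * ((1 + Real.log N) / N) *
        (2 * (1 + Real.log (M * N : ℕ))) + 1 / N) := by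
        have hlog : 0 ≤ Real.log N := Real.log_natCast_nonneg N
        gcongr
        exact sum_Icc_one_div_abs_le (M * N)
    _ = _ := by ring
end

section
/- There is a constant C such that for all integers N ≥ 2 and all positive integers ℓ₁, ℓ₂, the number of quadruples (j₁,k₁,j₂,k₂) ∈ {1,…,N}⁴ satisfying j₁ ≠ k₁, j₂ ≠ k₂, j₁+k₁ ≠ j₂+k₂, ℓ₁(j₁−k₁) = ℓ₂(j₂−k₂), and |ℓ₁(j₁²−k₁²) − ℓ₂(j₂²−k₂²)| ≤ N, is at most C (N²/ℓ₁) log N. -/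
/-- The number of `(M, H)` with `1 ≤ M ≤ 2N`, `1 ≤ H` and `ℓ * M * H ≤ N` is `O((N / ℓ) log N)`. -/
theorem sum_div_mul_le_log {N : ℕ} (hN : 2 ≤ N) (ℓ : ℕ) :
    ((∑ M ∈ Finset.Icc 1 (2 * N), N / (ℓ * M) : ℕ) : ℝ) ≤ 4 * ((N : ℝ) / ℓ) * Real.log N := by
  have hN' : (2 : ℝ) ≤ N := by exact_mod_cast hN
  have hterm : ((∑ M ∈ Finset.Icc 1 (2 * N), N / (ℓ * M) : ℕ) : ℝ)
      ≤ (N : ℝ) / ℓ * (harmonic (2 * N) : ℝ) := by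
    rw [harmonic_eq_sum_Icc]
    push_cast
    rw [Finset.mul_sum]
    refine Finset.sum_le_sum fun M _ => ?_
    refine Nat.cast_div_le.trans (le_of_eq ?_)
    push_cast
    rw [← div_div, div_eq_mul_inv]
  have hharm : (harmonic (2 * N) : ℝ) ≤ 4 * Real.log N := by
    have h := harmonic_le_one_add_log (2 * N)
    push_cast at h
    rw [Real.log_mul (by norm_num) (by linarith)] at h
    have h2 := Real.log_two_gt_d9
    have hlog : Real.log 2 ≤ Real.log N := Real.log_le_log (by norm_num) hN'
    linarith
  calc _ ≤ (N : ℝ) / ℓ * (harmonic (2 * N) : ℝ) := hterm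
    _ ≤ (N : ℝ) / ℓ * (4 * Real.log N) := by gcongr
    _ = _ := by ring

/-- A quadruple is recorded by `j₁ + k₁`, the signs and the absolute values of
`(j₁ + k₁) - (j₂ + k₂)` and `j₁ - k₁`. -/
def latticeCode (p : ℕ × ℕ × ℕ × ℕ) : ℕ × (Bool × Bool) × (_ : ℕ) × ℕ :=
  (p.1 + p.2.1, (decide (p.2.1 < p.1), decide (p.2.2.1 + p.2.2.2 < p.1 + p.2.1)),
    ⟨((p.1 + p.2.1 : ℤ) - (p.2.2.1 + p.2.2.2)).natAbs, ((p.1 : ℤ) - p.2.1).natAbs⟩)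

theorem latticeCode_injOn {ℓ₁ ℓ₂ : ℕ} (hℓ₂ : 1 ≤ ℓ₂) :
    Set.InjOn latticeCode {p | (ℓ₁ : ℤ) * ((p.1 : ℤ) - p.2.1) = ℓ₂ * ((p.2.2.1 : ℤ) - p.2.2.2)} := by
  rintro ⟨a, b, c, d⟩ hp ⟨a', b', c', d'⟩ hq h
  simp only [Set.mem_ofPred_eq] at hp hq
  simp only [latticeCode, Prod.mk.injEq, Sigma.mk.injEq, heq_eq_eq, decide_eq_decide] at h
  obtain ⟨hm, ⟨hs, ht⟩, hM, hH⟩ := h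
  have hh : (a : ℤ) - b = a' - b' := by omega
  have hh₂ : (c : ℤ) - d = c' - d' := by
    rw [hh, hq] at hp
    exact (mul_left_cancel₀ (by positivity) hp).symm
  simp only [Prod.mk.injEq]
  omega

theorem mul_natAbs_mul_natAbs_le {N ℓ₁ ℓ₂ : ℕ} {j₁ k₁ j₂ k₂ : ℤ}
    (he : ℓ₁ * (j₁ - k₁) = ℓ₂ * (j₂ - k₂))
    (hle : |ℓ₁ * (j₁ ^ 2 - k₁ ^ 2) - ℓ₂ * (j₂ ^ 2 - k₂ ^ 2)| ≤ N) :
    (j₁ - k₁).natAbs * (ℓ₁ * ((j₁ + k₁) - (j₂ + k₂)).natAbs) ≤ N := by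
  have key : ℓ₁ * (j₁ ^ 2 - k₁ ^ 2) - ℓ₂ * (j₂ ^ 2 - k₂ ^ 2)
      = (j₁ - k₁) * (ℓ₁ * ((j₁ + k₁) - (j₂ + k₂))) := by
    linear_combination (j₂ + k₂) * he
  rw [key, abs_mul, abs_mul, Nat.abs_cast] at hle
  zify
  exact hle


/-- Zelditch, 'inhomogeneous solutions' lattice-point count in the proof of Theorem 5.0.1:
the number of quadruples `(j₁,k₁,j₂,k₂) ∈ [1,N]⁴` with `j₁ ≠ k₁`, `j₂ ≠ k₂`,
`j₁+k₁ ≠ j₂+k₂`, `ℓ₁(j₁−k₁) = ℓ₂(j₂−k₂)` and `|ℓ₁(j₁²−k₁²) − ℓ₂(j₂²−k₂²)| ≤ N`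
is `O((N²/ℓ₁) log N)`. -/
theorem inhomogeneous_lattice_point_count :
    ∃ C : ℝ, ∀ N : ℕ, 2 ≤ N → ∀ ℓ₁ ℓ₂ : ℕ, 1 ≤ ℓ₁ → 1 ≤ ℓ₂ →
      ((Finset.Icc 1 N ×ˢ Finset.Icc 1 N ×ˢ Finset.Icc 1 N ×ˢ Finset.Icc 1 N).filter
          (fun p : ℕ × ℕ × ℕ × ℕ =>
            p.1 ≠ p.2.1 ∧ p.2.2.1 ≠ p.2.2.2 ∧ p.1 + p.2.1 ≠ p.2.2.1 + p.2.2.2 ∧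
            (ℓ₁ : ℤ) * ((p.1 : ℤ) - (p.2.1 : ℤ)) = (ℓ₂ : ℤ) * ((p.2.2.1 : ℤ) - (p.2.2.2 : ℤ)) ∧
            |(ℓ₁ : ℤ) * ((p.1 : ℤ) ^ 2 - (p.2.1 : ℤ) ^ 2)
              - (ℓ₂ : ℤ) * ((p.2.2.1 : ℤ) ^ 2 - (p.2.2.2 : ℤ) ^ 2)| ≤ (N : ℤ))).card
        ≤ C * ((N : ℝ) ^ 2 / ℓ₁) * Real.log N := by
  refine ⟨32, fun N hN ℓ₁ ℓ₂ hℓ₁ hℓ₂ => ?_⟩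
  let T : Finset (ℕ × (Bool × Bool) × (_ : ℕ) × ℕ) :=
    Finset.Icc 1 (2 * N) ×ˢ Finset.univ ×ˢ
      (Finset.Icc 1 (2 * N)).sigma fun M => Finset.Icc 1 (N / (ℓ₁ * M))
  have hT : T.card = 8 * N * ∑ M ∈ Finset.Icc 1 (2 * N), N / (ℓ₁ * M) := by
    simp only [T, Finset.card_product, Finset.card_sigma, Nat.card_Icc, Finset.card_univ,
      Fintype.card_prod, Fintype.card_bool, Nat.add_sub_cancel]
    ring
  refine (Nat.cast_le.mpr (Finset.card_le_card_of_injOn (t := T) latticeCode ?_ ?_)).trans ?_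
  · rintro ⟨a, b, c, d⟩ hp
    simp only [Finset.coe_filter, Finset.mem_product, Finset.mem_Icc, Set.mem_ofPred_eq] at hp
    obtain ⟨⟨ha, hb, hc, hd⟩, hab, -, hm, he, hle⟩ := hp
    have hbound := mul_natAbs_mul_natAbs_le he hle
    have hM : 1 ≤ ((a + b : ℤ) - (c + d)).natAbs := by omega
    simp only [T, latticeCode, Finset.mem_coe, Finset.mem_product,
      Finset.mem_sigma, Finset.mem_Icc, Finset.mem_univ, true_and,
      Nat.le_div_iff_mul_le (Nat.mul_pos hℓ₁ hM)]
    refine ⟨?_, ?_, ?_, hbound⟩ <;> omega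
  · refine (latticeCode_injOn (ℓ₁ := ℓ₁) hℓ₂).mono fun p hp => ?_
    exact (Finset.mem_filter.mp hp).2.2.2.2.1
  · rw [hT]
    calc _ ≤ 8 * (N : ℝ) * (4 * ((N : ℝ) / ℓ₁) * Real.log N) := by
          have := sum_div_mul_le_log hN ℓ₁
          rw [Nat.cast_mul, Nat.cast_mul, Nat.cast_ofNat]
          gcongr
      _ = _ := by ring
end

section
/- Let φ : [0,1] → ℝ be C² with 0 < c ≤ φ''(x) ≤ C' for all x ∈ [0,1] (so φ' is strictly increasing). For 0 ≤ y < x ≤ 1 let ξ(x,y) ∈ (y,x) be the unique point with φ(x) − φ(y) = φ'(ξ(x,y))·(x − y). Then for any two pairs (x₁,y₁), (x₂,y₂) with 0 ≤ y_i < x_i ≤ 1 and equal differences x₁ − y₁ = x₂ − y₂, one has (c/(2C'))·|(x₁+y₁) − (x₂+y₂)| ≤ |ξ(x₁,y₁) − ξ(x₂,y₂)| ≤ (C'/(2c))·|(x₁+y₁) − (x₂+y₂)|. -/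
open Set

/-- Bounds on the derivative over an interval bound the increment between its endpoints. -/
lemma mul_sub_le_sub_le_of_hasDerivWithinAt {f f' : ℝ → ℝ} {a b c C : ℝ} (hab : a ≤ b)
    (hf : ∀ t ∈ Icc a b, HasDerivWithinAt f (f' t) (Icc a b) t)
    (hc : ∀ t ∈ Icc a b, c ≤ f' t) (hC : ∀ t ∈ Icc a b, f' t ≤ C) :
    c * (b - a) ≤ f b - f a ∧ f b - f a ≤ C * (b - a) := by
  rcases hab.eq_or_lt with rfl | hlt
  · simp
  obtain ⟨t, ht, h⟩ := exists_hasDerivAt_eq_slope f f' hlt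
    (fun t ht => (hf t ht).continuousWithinAt)
    (fun t ht => (hf t (Ioo_subset_Icc_self ht)).hasDerivAt (Icc_mem_nhds ht.1 ht.2))
  have hpos : 0 < b - a := sub_pos.2 hlt
  rw [eq_div_iff hpos.ne'] at h
  have ht' := Ioo_subset_Icc_self ht
  rw [← h]
  exact ⟨mul_le_mul_of_nonneg_right (hc t ht') hpos.le,
    mul_le_mul_of_nonneg_right (hC t ht') hpos.le⟩

/-- If the increments of `φ' = g` are comparable to those of the identity, then translating an
interval to the right by `d` changes the mean slope of `φ` by an amount between `c * d` and
`C * d`. -/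
lemma slope_translate_bounds {φ g : ℝ → ℝ} {S : Set ℝ} {x y d c C p q : ℝ} (hS : S.OrdConnected)
    (hφ : ∀ t ∈ S, HasDerivWithinAt φ (g t) S t)
    (hg : ∀ a ∈ S, ∀ b ∈ S, a ≤ b → c * (b - a) ≤ g b - g a ∧ g b - g a ≤ C * (b - a))
    (hd : 0 ≤ d) (hxy : y < x) (hy : y ∈ S) (hx : x + d ∈ S)
    (hp : φ x - φ y = p * (x - y)) (hq : φ (x + d) - φ (y + d) = q * (x - y)) :
    c * d ≤ q - p ∧ q - p ≤ C * d := by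
  have hmem : ∀ t ∈ Icc y x, t ∈ S := fun t ht =>
    hS.out hy hx ⟨ht.1, by linarith [ht.2]⟩
  have hmem' : ∀ t ∈ Icc y x, t + d ∈ S := fun t ht =>
    hS.out hy hx ⟨by linarith [ht.1], by linarith [ht.2]⟩
  have hderiv : ∀ t ∈ Icc y x,
      HasDerivWithinAt (fun s => φ (s + d) - φ s) (g (t + d) - g t) (Icc y x) t := by
    intro t ht
    have h₁ : HasDerivWithinAt (fun s => φ (s + d)) (g (t + d) * 1) (Icc y x) t :=
      (hφ _ (hmem' t ht)).comp t ((hasDerivWithinAt_id t _).add_const d) hmem'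
    rw [mul_one] at h₁
    exact h₁.sub ((hφ t (hmem t ht)).mono hmem)
  have hbd : ∀ t ∈ Icc y x, c * d ≤ g (t + d) - g t ∧ g (t + d) - g t ≤ C * d := fun t ht => by
    simpa using hg t (hmem t ht) (t + d) (hmem' t ht) (by linarith)
  obtain ⟨hl, hu⟩ := mul_sub_le_sub_le_of_hasDerivWithinAt hxy.le hderiv
    (fun t ht => (hbd t ht).1) (fun t ht => (hbd t ht).2)
  have hpos : 0 < x - y := sub_pos.2 hxy
  have e : φ (x + d) - φ x - (φ (y + d) - φ y) = (q - p) * (x - y) := by linarith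
  rw [e] at hl hu
  exact ⟨le_of_mul_le_mul_right hl hpos, le_of_mul_le_mul_right hu hpos⟩

/-- Zelditch, key analytic lemma in the proof of Theorem 5.1.1: if `0 < c ≤ φ'' ≤ C'`
on `[0,1]`, then the mean-value abscissa `ξ(x,y)` (the point where
`φ(x) − φ(y) = φ'(ξ)(x−y)`) is bi-Lipschitz in the midpoint variable `x + y` for pairs
with equal differences: `(c/(2C'))|m₁ − m₂| ≤ |ξ₁ − ξ₂| ≤ (C'/(2c))|m₁ − m₂|`. -/
theorem mean_value_abscissa_biLipschitz
    (φ : ℝ → ℝ) (c C' : ℝ) (hc : 0 < c)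
    (hφ : ContDiffOn ℝ 2 φ (Set.Icc 0 1))
    (hφ'' : ∀ x ∈ Set.Icc (0:ℝ) 1,
      c ≤ iteratedDerivWithin 2 φ (Set.Icc 0 1) x ∧
      iteratedDerivWithin 2 φ (Set.Icc 0 1) x ≤ C')
    (x₁ y₁ x₂ y₂ ξ₁ ξ₂ : ℝ)
    (hy₁ : 0 ≤ y₁) (hxy₁ : y₁ < x₁) (hx₁ : x₁ ≤ 1)
    (hy₂ : 0 ≤ y₂) (hxy₂ : y₂ < x₂) (hx₂ : x₂ ≤ 1)
    (hdiff : x₁ - y₁ = x₂ - y₂)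
    (hξ₁ : ξ₁ ∈ Set.Ioo y₁ x₁) (hξ₂ : ξ₂ ∈ Set.Ioo y₂ x₂)
    (hmvt₁ : φ x₁ - φ y₁ = derivWithin φ (Set.Icc 0 1) ξ₁ * (x₁ - y₁))
    (hmvt₂ : φ x₂ - φ y₂ = derivWithin φ (Set.Icc 0 1) ξ₂ * (x₂ - y₂)) :
    (c / (2 * C')) * |(x₁ + y₁) - (x₂ + y₂)| ≤ |ξ₁ - ξ₂| ∧
    |ξ₁ - ξ₂| ≤ (C' / (2 * c)) * |(x₁ + y₁) - (x₂ + y₂)| := by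
  have hI : UniqueDiffOn ℝ (Icc (0:ℝ) 1) := uniqueDiffOn_Icc one_pos
  set g := derivWithin φ (Icc 0 1) with hg_def
  have hφd : ∀ t ∈ Icc (0:ℝ) 1, HasDerivWithinAt φ (g t) (Icc 0 1) t := fun t ht =>
    (hφ.differentiableOn (by norm_num) t ht).hasDerivWithinAt
  have hgC : ContDiffOn ℝ 1 g (Icc 0 1) := hφ.derivWithin hI (by norm_num)
  have hgd : ∀ t ∈ Icc (0:ℝ) 1,
      HasDerivWithinAt g (iteratedDerivWithin 2 φ (Icc 0 1) t) (Icc 0 1) t := by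
    intro t ht
    have h := (hgC.differentiableOn (by norm_num) t ht).hasDerivWithinAt
    rwa [show iteratedDerivWithin 2 φ (Icc 0 1) t = derivWithin g (Icc 0 1) t by
      simp only [iteratedDerivWithin_succ, iteratedDerivWithin_zero, hg_def]]
  have hg : ∀ a ∈ Icc (0:ℝ) 1, ∀ b ∈ Icc (0:ℝ) 1, a ≤ b →
      c * (b - a) ≤ g b - g a ∧ g b - g a ≤ C' * (b - a) := by
    intro a ha b hb hab
    have hsub : Icc a b ⊆ Icc 0 1 := Icc_subset_Icc ha.1 hb.2
    exact mul_sub_le_sub_le_of_hasDerivWithinAt hab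
      (fun t ht => (hgd t (hsub ht)).mono hsub)
      (fun t ht => (hφ'' t (hsub ht)).1) (fun t ht => (hφ'' t (hsub ht)).2)
  have hC : 0 < C' := by
    have h := hφ'' 0 (left_mem_Icc.2 zero_le_one)
    linarith [h.1, h.2]
  clear_value g
  clear hφ hφ'' hgC hgd hg_def
  wlog hle : x₁ ≤ x₂ generalizing x₁ y₁ x₂ y₂ ξ₁ ξ₂
  · rw [abs_sub_comm ξ₁, abs_sub_comm (x₁ + y₁)]
    exact this x₂ y₂ x₁ y₁ ξ₂ ξ₁ hy₂ hxy₂ hx₂ hy₁ hxy₁ hx₁ hdiff.symm hξ₂ hξ₁ hmvt₂ hmvt₁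
      (le_of_not_ge hle)
  obtain ⟨d, rfl⟩ : ∃ d, x₂ = x₁ + d := ⟨x₂ - x₁, by ring⟩
  obtain rfl : y₂ = y₁ + d := by linarith
  have hd : 0 ≤ d := by linarith
  obtain ⟨hl, hu⟩ := slope_translate_bounds ordConnected_Icc hφd hg hd hxy₁
    ⟨hy₁, by linarith⟩ ⟨by linarith, hx₂⟩ hmvt₁ (by rw [hmvt₂, hdiff])
  have hm₁ : ξ₁ ∈ Icc (0:ℝ) 1 := ⟨by linarith [hξ₁.1], by linarith [hξ₁.2]⟩
  have hm₂ : ξ₂ ∈ Icc (0:ℝ) 1 := ⟨by linarith [hξ₂.1], by linarith [hξ₂.2]⟩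
  have hξ : ξ₁ ≤ ξ₂ := by
    by_contra! hlt
    have h := (hg ξ₂ hm₂ ξ₁ hm₁ hlt.le).1
    linarith [mul_pos hc (sub_pos.2 hlt), mul_nonneg hc.le hd]
  obtain ⟨hl', hu'⟩ := hg ξ₁ hm₁ ξ₂ hm₂ hξ
  rw [abs_sub_comm ξ₁, abs_sub_comm (x₁ + y₁), abs_of_nonneg (sub_nonneg.2 hξ),
    show x₁ + d + (y₁ + d) - (x₁ + y₁) = 2 * d by ring, abs_of_nonneg (by linarith)]
  constructor
  · rw [show c / (2 * C') * (2 * d) = c * d / C' by field_simp, div_le_iff₀ hC]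
    linarith
  · rw [show C' / (2 * c) * (2 * d) = C' * d / c by field_simp, le_div_iff₀ hc]
    linarith
end
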